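/- arXiv:2404.04371 — 2 statements merged into one kernel-verified Lean document; each statement's English description precedes it below -/
import Mathlib

section
/- For every integer n ≥ 1, the polynomials Q₀, Q₁, …, Q_n form a ℂ-basis of the space Q_{n,1}(2). -/
noncomputable section

/-- Variables for polynomials in the entries of two `n × n` matrices `W` (`Sum.inl`) and
`Z` (`Sum.inr`). -/
abbrev WZVars (n : ℕ) := (Fin n × Fin n) ⊕ (Fin n × Fin n)

/-- The polynomial `Q_a(W,Z)` defined by `det(W + λ Z) = Σ_a Q_a(W,Z) λ^a`. -/
def Qpoly (n a : ℕ) : MvPolynomial (WZVars n) ℂ :=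
  Polynomial.coeff
    (Matrix.det (Matrix.of fun s t : Fin n =>
      Polynomial.C (MvPolynomial.X (Sum.inl (s, t))) +
        Polynomial.X * Polynomial.C (MvPolynomial.X (Sum.inr (s, t))))) a

/-- The substitution `Q(W,Z) ↦ Q(A W ᵗB, A Z ᵗB)` on polynomials. -/
def substWZ {n : ℕ} (A B : Matrix (Fin n) (Fin n) ℂ) :
    MvPolynomial (WZVars n) ℂ →ₐ[ℂ] MvPolynomial (WZVars n) ℂ :=
  MvPolynomial.aeval
    (Sum.elim
      (fun st : Fin n × Fin n =>
        ∑ p : Fin n, ∑ q : Fin n,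
          MvPolynomial.C (A st.1 p * B st.2 q) * MvPolynomial.X (Sum.inl (p, q)))
      (fun st : Fin n × Fin n =>
        ∑ p : Fin n, ∑ q : Fin n,
          MvPolynomial.C (A st.1 p * B st.2 q) * MvPolynomial.X (Sum.inr (p, q))))

/-- Membership in `Q_{n,v}(2)`: `Q(A W ᵗB, A Z ᵗB) = det(A)^v det(B)^v Q(W,Z)` for all
invertible `A, B`. -/
def MemQ (n v : ℕ) (Q : MvPolynomial (WZVars n) ℂ) : Prop :=
  ∀ A B : Matrix (Fin n) (Fin n) ℂ, IsUnit A.det → IsUnit B.det →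
    substWZ A B Q = MvPolynomial.C (A.det ^ v * B.det ^ v) * Q

/-- The space `Q_{n,v}(2)`, as a ℂ-submodule of the polynomial ring. -/
def QSub (n v : ℕ) : Submodule ℂ (MvPolynomial (WZVars n) ℂ) where
  carrier := {Q | MemQ n v Q}
  zero_mem' := by intro A B hA hB; simp
  add_mem' := by
    intro a b ha hb A B hA hB
    simp [map_add, ha A B hA hB, hb A B hA hB, mul_add]
  smul_mem' := by
    intro c Q hQ A B hA hB
    simp [map_smul, hQ A B hA hB, mul_smul_comm]

def rw' {n : ℕ} : WZVars n → Fin n := Sum.elim Prod.fst Prod.fst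
def cl' {n : ℕ} : WZVars n → Fin n := Sum.elim Prod.snd Prod.snd

lemma coeff_scale {σ : Type*} [Fintype σ] (c : σ → ℂ) (Q : MvPolynomial σ ℂ) (m : σ →₀ ℕ) :
    MvPolynomial.coeff m (MvPolynomial.aeval (fun v => MvPolynomial.C (c v) * MvPolynomial.X v) Q)
      = (∏ v, c v ^ m v) * MvPolynomial.coeff m Q := by
  classical
  induction Q using MvPolynomial.induction_on' with
  | monomial u a =>
    have : MvPolynomial.aeval (fun v => MvPolynomial.C (c v) * MvPolynomial.X v)
        (MvPolynomial.monomial u a) = MvPolynomial.C (∏ v, c v ^ u v) * MvPolynomial.monomial u a := by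
      rw [MvPolynomial.aeval_monomial, MvPolynomial.monomial_eq]
      rw [Finsupp.prod_fintype _ _ (by simp), Finsupp.prod_fintype _ _ (by simp)]
      simp only [mul_pow, Finset.prod_mul_distrib, map_prod, map_pow, MvPolynomial.algebraMap_eq]
      ring
    rw [this, MvPolynomial.coeff_C_mul, MvPolynomial.coeff_monomial]
    split_ifs with h
    · subst h; rfl
    · simp
  | add p q hp hq => rw [map_add, MvPolynomial.coeff_add, hp, hq, MvPolynomial.coeff_add, mul_add]

lemma subst_diag {n : ℕ} (a b : Fin n → ℂ) :
    substWZ (Matrix.diagonal a) (Matrix.diagonal b) =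
      MvPolynomial.aeval (fun v => MvPolynomial.C (a (rw' v) * b (cl' v)) * MvPolynomial.X v) := by
  apply MvPolynomial.algHom_ext
  rintro (⟨s, t⟩ | ⟨s, t⟩)
  all_goals
    simp only [substWZ, MvPolynomial.aeval_X, Sum.elim_inl, Sum.elim_inr, rw', cl']
    rw [Finset.sum_eq_single s, Finset.sum_eq_single t]
    · simp
    · intro q _ hq; simp [Matrix.diagonal_apply_ne' _ hq]
    · simp
    · intro q _ hq; simp [Matrix.diagonal_apply_ne' _ hq]
    · simp

def pm {n : ℕ} (σ : Equiv.Perm (Fin n)) : Matrix (Fin n) (Fin n) ℂ :=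
  (σ.toPEquiv.toMatrix : Matrix (Fin n) (Fin n) ℂ)

lemma subst_perm {n : ℕ} (σ τ : Equiv.Perm (Fin n)) :
    substWZ (pm σ) (pm τ) =
      MvPolynomial.rename (Sum.map (Prod.map σ τ) (Prod.map σ τ)) := by
  apply MvPolynomial.algHom_ext
  rintro (⟨s, t⟩ | ⟨s, t⟩)
  all_goals
    simp only [substWZ, MvPolynomial.aeval_X, Sum.elim_inl, Sum.elim_inr, pm,
      MvPolynomial.rename_X, Sum.map_inl, Sum.map_inr, Prod.map]
    rw [Finset.sum_eq_single (σ s), Finset.sum_eq_single (τ t)]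
    · simp [PEquiv.toMatrix_apply]
    · intro q _ hq; simp [PEquiv.toMatrix_apply, hq.symm]
    · simp
    · intro q _ hq; simp [PEquiv.toMatrix_apply, hq.symm]
    · simp

lemma det_pm {n : ℕ} (σ : Equiv.Perm (Fin n)) : (pm σ).det ≠ 0 := by
  unfold pm
  rw [Matrix.det_permutation]
  rcases Int.units_eq_one_or (Equiv.Perm.sign σ) with h | h <;> simp [h]

lemma coeff_perm {n : ℕ} {Q : MvPolynomial (WZVars n) ℂ} (hQ : Q ∈ QSub n 1)
    (σ τ : Equiv.Perm (Fin n)) (m : WZVars n →₀ ℕ)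
    (h : MvPolynomial.coeff (m.mapDomain (Sum.map (Prod.map σ τ) (Prod.map σ τ))) Q = 0) :
    MvPolynomial.coeff m Q = 0 := by
  have h1 := hQ (pm σ) (pm τ) (det_pm σ).isUnit (det_pm τ).isUnit
  rw [subst_perm] at h1
  have hinj : Function.Injective (Sum.map (Prod.map σ τ) (Prod.map σ τ)) :=
    (σ.injective.prodMap τ.injective).sumMap (σ.injective.prodMap τ.injective)
  rw [← MvPolynomial.coeff_rename_mapDomain _ hinj Q m, h1, MvPolynomial.coeff_C_mul, h, mul_zero]

lemma row_sum {n : ℕ} {Q : MvPolynomial (WZVars n) ℂ} (hQ : Q ∈ QSub n 1)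
    (m : WZVars n →₀ ℕ) (hm : MvPolynomial.coeff m Q ≠ 0) (i : Fin n) :
    ∑ v with rw' v = i, m v = 1 := by
  have hd : ∏ k, (Function.update (1 : Fin n → ℂ) i 2) k = 2 := by
    rw [Finset.prod_update_of_mem (Finset.mem_univ i)]; simp
  have h1 := hQ (Matrix.diagonal (Function.update 1 i 2)) (Matrix.diagonal 1)
    (by rw [Matrix.det_diagonal, hd]; simp) (by rw [Matrix.det_diagonal]; simp)
  rw [subst_diag, Matrix.det_diagonal, Matrix.det_diagonal, hd] at h1
  have h2 := congrArg (MvPolynomial.coeff m) h1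
  rw [coeff_scale, MvPolynomial.coeff_C_mul] at h2
  have h3 := mul_right_cancel₀ hm h2
  have h4 : ∏ v : WZVars n, (Function.update (1 : Fin n → ℂ) i 2 (rw' v) * (1 : Fin n → ℂ) (cl' v)) ^ m v
      = 2 ^ (∑ v with rw' v = i, m v) := by
    rw [← Finset.prod_pow_eq_pow_sum, Finset.prod_filter]
    refine Finset.prod_congr rfl fun v _ => ?_
    by_cases h : rw' v = i <;> simp [Function.update_apply, h]
  rw [h4] at h3
  have h5 : (2 : ℕ) ^ (∑ v with rw' v = i, m v) = 2 ^ 1 := by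
    have : ((2 : ℂ)) ^ (∑ v with rw' v = i, m v) = 2 ^ 1 := by simpa using h3
    exact_mod_cast this
  exact Nat.pow_right_injective le_rfl h5

lemma col_sum {n : ℕ} {Q : MvPolynomial (WZVars n) ℂ} (hQ : Q ∈ QSub n 1)
    (m : WZVars n →₀ ℕ) (hm : MvPolynomial.coeff m Q ≠ 0) (i : Fin n) :
    ∑ v with cl' v = i, m v = 1 := by
  have hd : ∏ k, (Function.update (1 : Fin n → ℂ) i 2) k = 2 := by
    rw [Finset.prod_update_of_mem (Finset.mem_univ i)]; simp
  have h1 := hQ (Matrix.diagonal 1) (Matrix.diagonal (Function.update 1 i 2))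
    (by rw [Matrix.det_diagonal]; simp) (by rw [Matrix.det_diagonal, hd]; simp)
  rw [subst_diag, Matrix.det_diagonal, Matrix.det_diagonal, hd] at h1
  have h2 := congrArg (MvPolynomial.coeff m) h1
  rw [coeff_scale, MvPolynomial.coeff_C_mul] at h2
  have h3 := mul_right_cancel₀ hm h2
  have h4 : ∏ v : WZVars n, ((1 : Fin n → ℂ) (rw' v) * Function.update (1 : Fin n → ℂ) i 2 (cl' v)) ^ m v
      = 2 ^ (∑ v with cl' v = i, m v) := by
    rw [← Finset.prod_pow_eq_pow_sum, Finset.prod_filter]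
    refine Finset.prod_congr rfl fun v _ => ?_
    by_cases h : cl' v = i <;> simp [Function.update_apply, h]
  rw [h4] at h3
  have h5 : (2 : ℕ) ^ (∑ v with cl' v = i, m v) = 2 ^ 1 := by
    have : ((2 : ℂ)) ^ (∑ v with cl' v = i, m v) = 2 ^ 1 := by simpa using h3
    exact_mod_cast this
  exact Nat.pow_right_injective le_rfl h5

def kd {n : ℕ} : WZVars n → Bool := Sum.isRight

def mk' {n : ℕ} (b : Bool) (s t : Fin n) : WZVars n := if b then Sum.inr (s, t) else Sum.inl (s, t)

lemma mk'_eta {n : ℕ} (v : WZVars n) : mk' (kd v) (rw' v) (cl' v) = v := by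
  rcases v with ⟨s, t⟩ | ⟨s, t⟩ <;> simp [mk', kd, rw', cl']

lemma map_mk' {n : ℕ} (σ τ : Equiv.Perm (Fin n)) (b : Bool) (s t : Fin n) :
    Sum.map (Prod.map σ τ) (Prod.map σ τ) (mk' b s t) = mk' b (σ s) (τ t) := by
  cases b <;> simp [mk']

def mstd (n a : ℕ) : WZVars n →₀ ℕ :=
  ∑ i : Fin n, Finsupp.single (mk' (decide ((i : ℕ) < a)) i i) 1

lemma exists_form {n : ℕ} (m : WZVars n →₀ ℕ)
    (hr : ∀ i, ∑ v with rw' v = i, m v = 1) (hc : ∀ i, ∑ v with cl' v = i, m v = 1) :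
    ∃ (b : Fin n → Bool) (τ : Equiv.Perm (Fin n)),
      m = ∑ i, Finsupp.single (mk' (b i) i (τ i)) 1 := by
  have key : ∀ i, ∃ v, rw' v = i ∧ m v = 1 ∧ ∀ u, rw' u = i → u ≠ v → m u = 0 := by
    intro i
    have h := hr i
    obtain ⟨v, hv, hne⟩ := Finset.exists_ne_zero_of_sum_ne_zero (h.trans_ne one_ne_zero)
    rw [← Finset.add_sum_erase _ _ hv] at h
    have h0 : ∑ x ∈ Finset.erase {v | rw' v = i} v, m x = 0 := by omega
    refine ⟨v, by simpa using hv, by omega, fun u hu huv => ?_⟩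
    rw [Finset.sum_eq_zero_iff] at h0
    exact h0 u (by simp [huv, hu])
  choose v hv1 hv2 hv3 using key
  have hinj : Function.Injective (fun i => cl' (v i)) := by
    intro i j hij
    by_contra hne
    have hvne : v i ≠ v j := fun h => hne (by rw [← hv1 i, ← hv1 j, h])
    have h := hc (cl' (v i))
    have h2 : ∑ x ∈ ({v i, v j} : Finset _), m x ≤ ∑ x with cl' x = cl' (v i), m x := by
      apply Finset.sum_le_sum_of_subset
      intro x hx
      simp only [Finset.mem_insert, Finset.mem_singleton] at hx
      rcases hx with rfl | rfl
      · simp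
      · simpa using hij.symm
    rw [Finset.sum_pair hvne, h, hv2, hv2] at h2
    omega
  refine ⟨fun i => kd (v i), Equiv.ofBijective _ (Finite.injective_iff_bijective.1 hinj), ?_⟩
  have : ∀ i, mk' (kd (v i)) i (cl' (v i)) = v i := fun i => by
    conv_rhs => rw [← mk'_eta (v i), hv1]
  simp only [Equiv.ofBijective_apply, this]
  ext u
  rw [Finsupp.finset_sum_apply, Finset.sum_eq_single (rw' u)]
  · by_cases h : u = v (rw' u)
    · rw [h, hv1, hv2]; simp
    · rw [hv3 _ u rfl h, Finsupp.single_eq_of_ne h]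
  · intro j _ hj
    apply Finsupp.single_eq_of_ne
    rintro rfl
    exact hj (hv1 j).symm
  · simp

lemma exists_perm {n : ℕ} (b : Fin n → Bool) :
    ∃ (a : Fin (n + 1)) (σ : Equiv.Perm (Fin n)), ∀ i, decide ((σ i : ℕ) < a) = b i := by
  have hle : Fintype.card {i // b i = true} ≤ n := by
    simpa using Fintype.card_subtype_le (fun i => b i = true)
  have hcard : Fintype.card {i // b i = true} =
      Fintype.card {i : Fin n // (i : ℕ) < Fintype.card {i // b i = true}} := by
    generalize Fintype.card {i // b i = true} = k at *
    rw [Fintype.card_subtype, Fin.card_filter_val_lt]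
    omega
  let e := Fintype.equivOfCardEq hcard
  refine ⟨⟨_, Nat.lt_succ_of_le hle⟩, e.extendSubtype, fun i => ?_⟩
  by_cases h : b i = true
  · rw [h, decide_eq_true_iff]; exact e.extendSubtype_mem i h
  · have := e.extendSubtype_not_mem i h
    simp only [Bool.not_eq_true] at h
    rw [h, decide_eq_false_iff_not]; exact this

lemma eq_zero_of {n : ℕ} {Q : MvPolynomial (WZVars n) ℂ} (hQ : Q ∈ QSub n 1)
    (h : ∀ a : Fin (n + 1), MvPolynomial.coeff (mstd n a) Q = 0) : Q = 0 := by
  ext m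
  rw [MvPolynomial.coeff_zero]
  by_contra hm
  obtain ⟨b, τ, hbt⟩ := exists_form m (row_sum hQ m hm) (col_sum hQ m hm)
  obtain ⟨a, σ, hσ⟩ := exists_perm b
  refine hm (coeff_perm hQ σ (τ.symm.trans σ) m ?_)
  convert h a using 2
  rw [hbt, Finsupp.mapDomain_finset_sum]
  simp only [Finsupp.mapDomain_single, map_mk', Equiv.trans_apply, Equiv.symm_apply_apply]
  unfold mstd
  rw [← Equiv.sum_comp σ (fun i : Fin n => Finsupp.single (mk' (decide ((i : ℕ) < a)) i i) 1)]
  simp only [hσ]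

lemma Qpoly_mem (n a : ℕ) : Qpoly n a ∈ QSub n 1 := by
  intro A B _ _
  unfold Qpoly
  rw [pow_one, pow_one, ← Polynomial.coeff_C_mul]
  have : ∀ (p : Polynomial (MvPolynomial (WZVars n) ℂ)), substWZ A B (p.coeff a) =
      (p.map (substWZ A B : MvPolynomial (WZVars n) ℂ →+* MvPolynomial (WZVars n) ℂ)).coeff a := by
    intro p; rw [Polynomial.coeff_map]; rfl
  rw [this, ← Polynomial.coe_mapRingHom, RingHom.map_det]
  congr 1
  set f : ℂ →+* Polynomial (MvPolynomial (WZVars n) ℂ) := Polynomial.C.comp MvPolynomial.C with hf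
  have e : Polynomial.C (MvPolynomial.C (A.det * B.det)) = f A.det * f B.det := by
    simp [hf]
  rw [e, RingHom.map_det, RingHom.map_det, ← Matrix.det_transpose (f.mapMatrix B), mul_right_comm,
    ← Matrix.det_mul, ← Matrix.det_mul]
  congr 1
  ext1 s t
  simp only [RingHom.mapMatrix_apply, Matrix.map_apply, Matrix.of_apply, Matrix.mul_apply,
    Matrix.transpose_apply, hf, Polynomial.coe_mapRingHom, Polynomial.map_add, Polynomial.map_mul,
    Polynomial.map_C, Polynomial.map_X, RingHom.coe_coe, substWZ, MvPolynomial.aeval_X,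
    Sum.elim_inl, Sum.elim_inr, map_sum, map_mul, RingHom.comp_apply, Finset.mul_sum,
    Finset.sum_mul, ← Finset.sum_add_distrib]
  rw [Finset.sum_comm]
  refine Finset.sum_congr rfl fun q _ => Finset.sum_congr rfl fun p _ => ?_
  ring

lemma Qpoly_li (n : ℕ) : LinearIndependent ℂ (fun a : Fin (n + 1) => Qpoly n (a : ℕ)) := by
  let g : MvPolynomial (WZVars n) ℂ →ₐ[ℂ] Polynomial ℂ := MvPolynomial.aeval
    (Sum.elim (fun st => if st.1 = st.2 then 1 else 0)
      (fun st => if st.1 = st.2 then Polynomial.X else 0))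
  have hg : ∀ a : ℕ, g (Qpoly n a) = (n.choose a : ℂ) • Polynomial.X ^ a := by
    intro a
    have : ∀ (p : Polynomial (MvPolynomial (WZVars n) ℂ)), g (p.coeff a) =
      (p.map (g : MvPolynomial (WZVars n) ℂ →+* Polynomial ℂ)).coeff a := by
      intro p; rw [Polynomial.coeff_map]; rfl
    unfold Qpoly
    rw [this, ← Polynomial.coe_mapRingHom, RingHom.map_det]
    have hM : (Polynomial.mapRingHom (g : MvPolynomial (WZVars n) ℂ →+* Polynomial ℂ)).mapMatrix
        (Matrix.of fun s t : Fin n =>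
          Polynomial.C (MvPolynomial.X (Sum.inl (s, t))) +
          Polynomial.X * Polynomial.C (MvPolynomial.X (Sum.inr (s, t)))) =
        Matrix.diagonal (fun _ : Fin n =>
          (1 + Polynomial.X * Polynomial.C Polynomial.X : Polynomial (Polynomial ℂ))) := by
      ext1 s t
      by_cases h : s = t
      · subst h; simp [g]
      · simp [g, h]
    rw [hM, Matrix.det_diagonal]
    simp only [Finset.prod_const, Finset.card_univ, Fintype.card_fin]
    have h2 : ((1 + Polynomial.X * Polynomial.C Polynomial.X : Polynomial (Polynomial ℂ))) ^ n =
      ((1 + Polynomial.X) ^ n : Polynomial (Polynomial ℂ)).comp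
        (Polynomial.C Polynomial.X * Polynomial.X) := by
      rw [Polynomial.pow_comp, Polynomial.add_comp, Polynomial.one_comp, Polynomial.X_comp,
        mul_comm Polynomial.X]
    rw [h2, Polynomial.comp_C_mul_X_coeff, Polynomial.coeff_one_add_X_pow]
    rw [Polynomial.smul_eq_C_mul]; simp
  rw [Fintype.linearIndependent_iff]
  intro c hc i
  have h := congrArg (fun p => Polynomial.coeff (g p) (i : ℕ)) hc
  simp only [map_sum, map_smul, hg, Polynomial.finset_sum_coeff, Polynomial.coeff_smul,
    Polynomial.coeff_X_pow, map_zero, Polynomial.coeff_zero] at h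
  rw [Finset.sum_eq_single i] at h
  · have hne : (n.choose (i : ℕ) : ℂ) ≠ 0 := by
      exact_mod_cast (Nat.choose_pos (Nat.le_of_lt_succ i.2)).ne'
    simpa [hne] using h
  · intro j _ hj
    have : (i : ℕ) ≠ j := fun h => hj (Fin.ext h.symm)
    simp [this]
  · simp

/-- For every `n ≥ 1`, the polynomials `Q₀, Q₁, …, Q_n` form a ℂ-basis of `Q_{n,1}(2)`:
they are linearly independent and span `Q_{n,1}(2)`. -/
theorem stmt7 (n : ℕ) (hn : 1 ≤ n) :
    LinearIndependent ℂ (fun a : Fin (n + 1) => Qpoly n (a : ℕ)) ∧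
      Submodule.span ℂ (Set.range fun a : Fin (n + 1) => Qpoly n (a : ℕ)) = QSub n 1 := by
  refine ⟨Qpoly_li n, ?_⟩
  let φ : QSub n 1 →ₗ[ℂ] (Fin (n + 1) → ℂ) :=
    (LinearMap.pi fun a : Fin (n + 1) => MvPolynomial.lcoeff ℂ (mstd n a)).comp (QSub n 1).subtype
  have hφ : Function.Injective φ := by
    rw [injective_iff_map_eq_zero]
    rintro ⟨Q, hQ⟩ h
    exact Subtype.ext (eq_zero_of hQ fun a => congrFun h a)
  haveI : FiniteDimensional ℂ (QSub n 1) := FiniteDimensional.of_injective φ hφ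
  apply Submodule.eq_of_le_of_finrank_le
  · rw [Submodule.span_le]
    rintro _ ⟨a, rfl⟩
    exact Qpoly_mem n a
  · rw [finrank_span_eq_card (Qpoly_li n)]
    simpa using LinearMap.finrank_le_finrank_of_injective hφ
end
end

section
/- Let P(X,Y) be a homogeneous polynomial in the entries of X, Y ∈ M_{n,k}(ℂ), identified with ℂ^N where N = nk. If for every z ∈ ℂ^N one has ∫_{ℂ^N} e^{−i⟨w,z⟩} e^{−i⟨z,w⟩} e^{−⟨w,w⟩} P(w, w̄) |dw|² = (2π)^N e^{−⟨z,z⟩} P(−iz, −iz̄), then P is harmonic. Here ⟨w,z⟩ = Tr(w z*) is the standard Hermitian form on ℂ^N, w̄ denotes complex conjugation, and |dw|² = 2^N times Lebesgue measure on ℂ^N ≅ ℝ^{2N}. -/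
noncomputable section

open MeasureTheory

/-- Variables for polynomials `P(X,Y)` in the entries of two `n × k` matrices:
`Sum.inl (s,u)` is `x_{s,u}`, `Sum.inr (s,u)` is `y_{s,u}`. -/
abbrev XYVars (n k : ℕ) := (Fin n × Fin k) ⊕ (Fin n × Fin k)

/-- Evaluation `P(a, b)` of `P(X,Y)` at `X = a`, `Y = b`. -/
def evalP {n k : ℕ} (P : MvPolynomial (XYVars n k) ℂ) (a b : Fin n × Fin k → ℂ) : ℂ :=
  MvPolynomial.eval (Sum.elim a b) P

/-- The operator `Δ_{s,t} = Σ_u ∂²/(∂x_{s,u}∂y_{t,u})`. -/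
def Delta {n k : ℕ} (s t : Fin n) (P : MvPolynomial (XYVars n k) ℂ) :
    MvPolynomial (XYVars n k) ℂ :=
  ∑ u : Fin k,
    MvPolynomial.pderiv (Sum.inl (s, u)) (MvPolynomial.pderiv (Sum.inr (t, u)) P)

/-- `P` is harmonic if `Σ_s Δ_{s,s} P = 0`. -/
def Harmonic {n k : ℕ} (P : MvPolynomial (XYVars n k) ℂ) : Prop :=
  ∑ s : Fin n, Delta s s P = 0

/-- The substitution `P(X,Y) ↦ P(AX, BY)` on polynomials. -/
def substAB {n k : ℕ} (A B : Matrix (Fin n) (Fin n) ℂ) :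
    MvPolynomial (XYVars n k) ℂ →ₐ[ℂ] MvPolynomial (XYVars n k) ℂ :=
  MvPolynomial.aeval
    (Sum.elim
      (fun p : Fin n × Fin k =>
        ∑ t : Fin n, MvPolynomial.C (A p.1 t) * MvPolynomial.X (Sum.inl (t, p.2)))
      (fun p : Fin n × Fin k =>
        ∑ t : Fin n, MvPolynomial.C (B p.1 t) * MvPolynomial.X (Sum.inr (t, p.2))))

/-- The standard Hermitian form `⟨w,z⟩ = Tr(w z*) = Σ_p w_p conj(z_p)` on `ℂ^N ≅ M_{n,k}(ℂ)`. -/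
def herm {n k : ℕ} (w z : Fin n × Fin k → ℂ) : ℂ :=
  ∑ p : Fin n × Fin k, w p * (starRingEnd ℂ) (z p)

open MvPolynomial in
theorem pd_comm {σ : Type*} (i j : σ) (P : MvPolynomial σ ℂ) :
    pderiv i (pderiv j P) = pderiv j (pderiv i P) := by
  classical
  have h : ⁅(pderiv i : Derivation ℂ (MvPolynomial σ ℂ) (MvPolynomial σ ℂ)),
      (pderiv j : Derivation ℂ (MvPolynomial σ ℂ) (MvPolynomial σ ℂ))⁆ = 0 := by
    apply MvPolynomial.derivation_ext
    intro l
    rw [Derivation.commutator_apply, pderiv_X, pderiv_X]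
    by_cases h1 : l = i <;> by_cases h2 : l = j <;> simp [Pi.single_apply, h1, h2] <;> split_ifs <;> simp
  have := congrArg (fun D => D P) h
  simpa [Derivation.commutator_apply, sub_eq_zero] using this

def LL (n k : ℕ) : MvPolynomial (XYVars n k) ℂ →ₗ[ℂ] MvPolynomial (XYVars n k) ℂ :=
  ∑ p : Fin n × Fin k, 
    (MvPolynomial.pderiv (R := ℂ) (Sum.inl p : XYVars n k)).toLinearMap ∘ₗ
    (MvPolynomial.pderiv (R := ℂ) (Sum.inr p : XYVars n k)).toLinearMap

section
open MvPolynomial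
variable {n k : ℕ}

theorem LL_apply (P : MvPolynomial (XYVars n k) ℂ) :
    LL n k P = ∑ p : Fin n × Fin k, pderiv (Sum.inl p) (pderiv (Sum.inr p) P) := by
  simp [LL]

theorem LL_harm (P : MvPolynomial (XYVars n k) ℂ) : Harmonic P ↔ LL n k P = 0 := by
  rw [LL_apply, Fintype.sum_prod_type]; rfl

theorem LL_X (i : XYVars n k) (P : MvPolynomial (XYVars n k) ℂ) :
    LL n k (X i * P) = X i * LL n k P + pderiv i.swap P := by
  classical
  rw [LL_apply, LL_apply, Finset.mul_sum]
  rcases i with q | q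
  · have : ∀ p : Fin n × Fin k, pderiv (Sum.inl p) (pderiv (Sum.inr p)
        ((X (Sum.inl q) : MvPolynomial (XYVars n k) ℂ) * P)) =
        X (Sum.inl q) * pderiv (Sum.inl p) (pderiv (Sum.inr p) P) +
        if p = q then pderiv (Sum.inr p) P else 0 := by
      intro p
      by_cases h : p = q
      · subst h; simp [Derivation.leibniz, pderiv_X]
      · simp [Derivation.leibniz, pderiv_X, h, Ne.symm h]
    simp_rw [this, Finset.sum_add_distrib]; simp
  · have : ∀ p : Fin n × Fin k, pderiv (Sum.inl p) (pderiv (Sum.inr p)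
        ((X (Sum.inr q) : MvPolynomial (XYVars n k) ℂ) * P)) =
        X (Sum.inr q) * pderiv (Sum.inl p) (pderiv (Sum.inr p) P) +
        if p = q then pderiv (Sum.inl p) P else 0 := by
      intro p
      by_cases h : p = q
      · subst h; simp [Derivation.leibniz, pderiv_X]
      · simp [Derivation.leibniz, pderiv_X, h, Ne.symm h]
    simp_rw [this, Finset.sum_add_distrib]; simp

theorem LL_pd (i : XYVars n k) (P : MvPolynomial (XYVars n k) ℂ) :
    LL n k (pderiv i P) = pderiv i (LL n k P) := by
  rw [LL_apply, LL_apply, map_sum]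
  refine Finset.sum_congr rfl fun p _ => ?_
  rw [pd_comm _ i, pd_comm _ i]

theorem LLpow_pd (i : XYVars n k) (m : ℕ) (P : MvPolynomial (XYVars n k) ℂ) :
    (LL n k ^ m) (pderiv i P) = pderiv i ((LL n k ^ m) P) := by
  induction m with
  | zero => simp
  | succ m ih => rw [pow_succ', Module.End.mul_apply, ih, LL_pd, Module.End.mul_apply]

theorem LLpow_X (i : XYVars n k) (m : ℕ) (P : MvPolynomial (XYVars n k) ℂ) :
    (LL n k ^ (m+1)) (X i * P) = X i * (LL n k ^ (m+1)) P +
      ((m : ℂ) + 1) • pderiv i.swap ((LL n k ^ m) P) := by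
  induction m with
  | zero => simp [LL_X]
  | succ m ih =>
    rw [pow_succ', Module.End.mul_apply, ih, map_add, LL_X, map_smul, LL_pd,
      ← Module.End.mul_apply, ← pow_succ', ← Module.End.mul_apply, ← pow_succ']
    push_cast
    module

theorem LLpow_zero_mono {P : MvPolynomial (XYVars n k) ℂ} {m M : ℕ} (h : m ≤ M)
    (hm : (LL n k ^ m) P = 0) : (LL n k ^ M) P = 0 := by
  obtain ⟨d, rfl⟩ := Nat.exists_eq_add_of_le' h
  rw [pow_add, Module.End.mul_apply, hm, map_zero]

theorem LL_nil (P : MvPolynomial (XYVars n k) ℂ) : ∃ m, (LL n k ^ m) P = 0 := by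
  induction P using MvPolynomial.induction_on with
  | C a => exact ⟨1, by simp [LL_apply]⟩
  | add p q hp hq =>
    obtain ⟨a, ha⟩ := hp
    obtain ⟨b, hb⟩ := hq
    exact ⟨max a b, by rw [map_add, LLpow_zero_mono (le_max_left a b) ha,
      LLpow_zero_mono (le_max_right a b) hb, add_zero]⟩
  | mul_X p i hp =>
    obtain ⟨a, ha⟩ := hp
    refine ⟨a+1, ?_⟩
    rw [mul_comm, LLpow_X, ha, LLpow_zero_mono (Nat.le_succ a) ha]
    simp

def EE (n k M : ℕ) : MvPolynomial (XYVars n k) ℂ →ₗ[ℂ] MvPolynomial (XYVars n k) ℂ :=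
  ∑ j ∈ Finset.range M, (((-1 : ℂ)^j / (j.factorial : ℂ)) • LL n k ^ j)

theorem EE_apply (M : ℕ) (P : MvPolynomial (XYVars n k) ℂ) :
    EE n k M P = ∑ j ∈ Finset.range M, ((-1 : ℂ)^j / (j.factorial : ℂ)) • (LL n k ^ j) P := by
  simp [EE]

theorem EE_stable {P : MvPolynomial (XYVars n k) ℂ} {m M : ℕ} (h : m ≤ M)
    (hm : (LL n k ^ m) P = 0) : EE n k M P = EE n k m P := by
  rw [EE_apply, EE_apply]
  symm
  apply Finset.sum_subset (Finset.range_mono h)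
  intro j _ hj
  rw [LLpow_zero_mono (by simpa using hj) hm, smul_zero]

theorem EE_X (i : XYVars n k) (M : ℕ) (P : MvPolynomial (XYVars n k) ℂ) :
    EE n k (M+1) (X i * P) = X i * EE n k (M+1) P - pderiv i.swap (EE n k M P) := by
  simp only [EE_apply]
  rw [Finset.sum_range_succ', Finset.sum_range_succ' _ M, mul_add, Finset.mul_sum, map_sum]
  rw [add_sub_right_comm, ← Finset.sum_sub_distrib]
  congr 1
  · refine Finset.sum_congr rfl fun j _ => ?_
    rw [LLpow_X, Derivation.map_smul, smul_add, smul_smul, mul_smul_comm, sub_eq_add_neg, ← neg_smul]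
    congr 2
    rw [Nat.factorial_succ]
    have : (j.factorial : ℂ) ≠ 0 := by exact_mod_cast j.factorial_ne_zero
    have : (j : ℂ) + 1 ≠ 0 := by exact_mod_cast j.succ_ne_zero
    push_cast
    field_simp
    ring
  · simp

theorem EE_surj (m : ℕ) : ∀ D : MvPolynomial (XYVars n k) ℂ, (LL n k ^ m) D = 0 →
    ∃ Q, (LL n k ^ m) Q = 0 ∧ EE n k m Q = D := by
  induction m with
  | zero => intro D hD; exact ⟨0, by simp, by simpa using hD.symm⟩
  | succ m ih =>
    intro D hD
    have hc : ∀ a b : ℕ, (LL n k ^ a) ((LL n k ^ b) D) = (LL n k ^ (a + b)) D := by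
      intro a b; rw [pow_add, Module.End.mul_apply]
    have h1 : (LL n k ^ m) (D - EE n k (m+1) D) = 0 := by
      rw [EE_apply, Finset.sum_range_succ', map_sub, map_add, map_sum]
      rw [Finset.sum_eq_zero]
      · simp
      · intro j _
        rw [map_smul, hc, LLpow_zero_mono (by omega) hD, smul_zero]
    obtain ⟨Q, hQ, hE⟩ := ih _ h1
    refine ⟨D + Q, ?_, ?_⟩
    · rw [map_add, hD, LLpow_zero_mono (Nat.le_succ m) hQ, add_zero]
    · rw [map_add, EE_stable (Nat.le_succ m) hQ, hE]; abel

theorem II_EE (I : MvPolynomial (XYVars n k) ℂ →ₗ[ℂ] ℂ) (c : XYVars n k → ℂ)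
    (hI : ∀ i Q, I (X i * Q) = c i * I Q + I (pderiv i.swap Q))
    (Q : MvPolynomial (XYVars n k) ℂ) :
    ∃ M0, ∀ M ≥ M0, I (EE n k M Q) = I 1 * eval c Q := by
  induction Q using MvPolynomial.induction_on with
  | C a =>
    refine ⟨1, fun M hM => ?_⟩
    rw [EE_stable hM (by simp [LL_apply]), EE_apply]
    have : (C a : MvPolynomial (XYVars n k) ℂ) = a • 1 := by simp [MvPolynomial.smul_eq_C_mul]
    simp only [Finset.range_one, Finset.sum_singleton, pow_zero, Nat.factorial_zero, Nat.cast_one,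
      div_one, one_smul, Module.End.one_apply, eval_C]
    rw [this, map_smul, smul_eq_mul, mul_comm]
  | add p q hp hq =>
    obtain ⟨a, ha⟩ := hp
    obtain ⟨b, hb⟩ := hq
    refine ⟨max a b, fun M hM => ?_⟩
    rw [map_add, map_add, ha M (le_trans (le_max_left _ _) hM),
      hb M (le_trans (le_max_right _ _) hM), map_add, mul_add]
  | mul_X p i hp =>
    obtain ⟨a, ha⟩ := hp
    obtain ⟨m, hm⟩ := LL_nil p
    refine ⟨max a m + 1, fun M hM => ?_⟩
    obtain ⟨M, rfl⟩ : ∃ M', M = M' + 1 := ⟨M - 1, by omega⟩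
    have h1 : a ≤ M := by have := le_max_left a m; omega
    have h2 : m ≤ M := by have := le_max_right a m; omega
    rw [mul_comm p, EE_X, map_sub, hI, ha _ (by omega), EE_stable (m := m) (by omega) hm,
      EE_stable h2 hm, map_mul, eval_X]
    ring

theorem II_EE' (I : MvPolynomial (XYVars n k) ℂ →ₗ[ℂ] ℂ) (c : XYVars n k → ℂ)
    (hI : ∀ i Q, I (X i * Q) = c i * I Q + I (pderiv i.swap Q))
    (Q : MvPolynomial (XYVars n k) ℂ) (m : ℕ) (hm : (LL n k ^ m) Q = 0) :
    I (EE n k m Q) = I 1 * eval c Q := by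
  obtain ⟨M, hM⟩ := II_EE I c hI Q
  rw [← hM (max m M) (le_max_right _ _), EE_stable (le_max_left _ _) hm]

theorem harm_of_EE (P : MvPolynomial (XYVars n k) ℂ) (m : ℕ) (hm : (LL n k ^ m) P = 0)
    (h : EE n k m P = P) : LL n k P = 0 := by
  classical
  by_contra hne
  let l := Nat.find (LL_nil P)
  have hl : (LL n k ^ l) P = 0 := Nat.find_spec (LL_nil P)
  have hmin : ∀ a < l, (LL n k ^ a) P ≠ 0 := fun a ha => Nat.find_min (LL_nil P) ha
  have hl2 : 2 ≤ l := by
    by_contra hc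
    apply hne
    have := LLpow_zero_mono (M := 1) (by omega) hl
    simpa using this
  obtain ⟨r, hr⟩ : ∃ r, l = r + 2 := ⟨l - 2, by omega⟩
  have h' : EE n k (m + 2) P = P := by rw [EE_stable (by omega) hm, h]
  have hc : ∀ a b : ℕ, (LL n k ^ a) ((LL n k ^ b) P) = (LL n k ^ (a + b)) P := by
    intro a b; rw [pow_add, Module.End.mul_apply]
  have h2 := congrArg (LL n k ^ r) h'
  rw [EE_apply, Finset.sum_range_succ', Finset.sum_range_succ', map_add, map_add, map_sum,
    Finset.sum_eq_zero] at h2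
  · simp only [map_smul, hc] at h2
    refine hmin (r+1) (by omega) ?_
    simpa using h2
  · intro j _
    rw [map_smul, hc, LLpow_zero_mono (by omega) hl, smul_zero]

theorem dense_zero (Q : MvPolynomial (XYVars n k) ℂ)
    (h : ∀ z : Fin n × Fin k → ℂ, eval (Sum.elim (fun p => -Complex.I * z p)
      (fun p => -Complex.I * (starRingEnd ℂ) (z p))) Q = 0) : Q = 0 := by
  let f : XYVars n k → MvPolynomial (XYVars n k) ℂ := Sum.elim
    (fun p => C (-Complex.I) * (X (Sum.inl p) + C Complex.I * X (Sum.inr p)))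
    (fun p => C (-Complex.I) * (X (Sum.inl p) - C Complex.I * X (Sum.inr p)))
  have hev : ∀ x : XYVars n k → ℂ, eval x (aeval f Q) = eval (fun i => eval x (f i)) Q := by
    intro x
    clear h
    induction Q using MvPolynomial.induction_on with
    | C a => simp
    | add p q hp hq => simp only [map_add, hp, hq]
    | mul_X p i hp => simp only [map_mul, hp, aeval_X, eval_X]
  have hz : aeval f Q = 0 := by
    apply MvPolynomial.funext_set (fun _ => Set.range (fun r : ℝ => (r : ℂ)))
    · intro _; exact Set.infinite_range_of_injective Complex.ofReal_injective
    intro x hx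
    have hx' : ∀ i, ∃ r : ℝ, (r : ℂ) = x i := fun i => hx i (Set.mem_univ i)
    choose r hr using hx'
    rw [hev, map_zero, ← h (fun p => x (Sum.inl p) + Complex.I * x (Sum.inr p))]
    congr 1
    congr 1
    ext i
    rcases i with p | p
    · simp [f]
    · simp [f, ← hr]
      ring
  apply MvPolynomial.funext
  intro y
  have := hev (Sum.elim (fun p => (Complex.I * (y (Sum.inl p) + y (Sum.inr p))) / 2)
    (fun p => (y (Sum.inl p) - y (Sum.inr p)) / 2))
  rw [hz, map_zero] at this
  rw [map_zero, this]
  congr 1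
  congr 1
  ext i
  rcases i with p | p
  · simp [f]; ring_nf; simp
  · simp [f]; ring_nf; simp

end

def k1 (ζ w : ℂ) : ℂ := Complex.exp (-Complex.I * (w * (starRingEnd ℂ) ζ)) *
  Complex.exp (-Complex.I * (ζ * (starRingEnd ℂ) w)) * Complex.exp (-(w * (starRingEnd ℂ) w))

theorem k1_eq (ζ w : ℂ) : k1 ζ w =
    Complex.exp (-1 * (‖w‖ : ℂ) ^ 2 + (-2 * Complex.I) * ((inner ℝ ζ w : ℝ) : ℂ)) := by
  rw [k1, ← Complex.exp_add, ← Complex.exp_add]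
  congr 1
  rw [Complex.mul_conj', Complex.inner]
  have h : w * (starRingEnd ℂ) ζ + ζ * (starRingEnd ℂ) w =
      2 * ((((starRingEnd ℂ) ζ * w).re : ℝ) : ℂ) := by
    have := Complex.add_conj ((starRingEnd ℂ) ζ * w)
    rw [map_mul, Complex.conj_conj] at this
    rw [← Complex.ofReal_ofNat, ← Complex.ofReal_mul, ← this]
    ring
  have h2 : ((starRingEnd ℂ) ζ * w).re = (w * (starRingEnd ℂ) ζ).re := by rw [mul_comm]
  first
  | linear_combination (-Complex.I) * h
  | (rw [h2] at h; linear_combination (-Complex.I) * h)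

theorem k1_int (ζ : ℂ) : ∫ w : ℂ, k1 ζ w = Real.pi * Complex.exp (-(ζ * (starRingEnd ℂ) ζ)) := by
  simp_rw [k1_eq]
  have := GaussianFourier.integral_cexp_neg_mul_sq_norm_add (b := 1) (V := ℂ) (by simp) (-2 * Complex.I) ζ
  rw [this, Complex.mul_conj']
  simp only [Complex.finrank_real_complex]
  norm_num
  rw [mul_pow, Complex.I_sq]
  congr 1
  ring

theorem k1_norm (ζ w : ℂ) : ‖k1 ζ w‖ = Real.exp (-‖w‖ ^ 2) := by
  rw [k1_eq, Complex.norm_exp]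
  congr 1
  simp [← Complex.ofReal_pow]

theorem k1_cont (ζ : ℂ) : Continuous (k1 ζ) := by
  unfold k1
  have := Complex.continuous_conj
  fun_prop

theorem k1_integrable (ζ : ℂ) (a b : ℕ) :
    Integrable (fun w : ℂ => k1 ζ w * (w ^ a * (starRingEnd ℂ) w ^ b)) := by
  have h := Complex.integral_rpow_mul_exp_neg_rpow (p := 2) (q := (a + b : ℕ)) (by norm_num)
    (by have : (0 : ℝ) ≤ (a + b : ℕ) := Nat.cast_nonneg _
        linarith)
  have hi : Integrable (fun x : ℂ => ‖x‖ ^ ((a + b : ℕ) : ℝ) * Real.exp (-‖x‖ ^ (2 : ℝ))) := by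
    apply Integrable.of_integral_ne_zero
    rw [h]
    have : 0 < Real.Gamma ((((a + b : ℕ) : ℝ) + 2) / 2) := Real.Gamma_pos_of_pos (by positivity)
    have := Real.pi_pos
    positivity
  refine hi.mono' ?_ ?_
  · have := k1_cont ζ
    have := Complex.continuous_conj
    exact Continuous.aestronglyMeasurable (by fun_prop)
  · refine Filter.Eventually.of_forall fun w => ?_
    rw [norm_mul, k1_norm, norm_mul, norm_pow, norm_pow, RCLike.norm_conj, ← pow_add, mul_comm,
      Real.rpow_natCast, Real.rpow_ofNat]

section
variable {n k : ℕ}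

def KK (z w : Fin n × Fin k → ℂ) : ℂ :=
  Complex.exp (-Complex.I * herm w z) * Complex.exp (-Complex.I * herm z w) *
              Complex.exp (-herm w w)

theorem KK_prod (z w : Fin n × Fin k → ℂ) : KK z w = ∏ p, k1 (z p) (w p) := by
  simp only [KK, k1, herm, Finset.mul_sum, Complex.exp_sum, ← Finset.sum_neg_distrib,
    Finset.prod_mul_distrib]

theorem KK_int (z : Fin n × Fin k → ℂ) : ∫ w, KK z w =
    (Real.pi : ℂ) ^ (n * k) * Complex.exp (-herm z z) := by
  simp_rw [KK_prod]
  rw [integral_fintype_prod_volume_eq_prod]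
  simp_rw [k1_int]
  simp only [herm, Complex.exp_sum, ← Finset.sum_neg_distrib,
    Finset.prod_mul_distrib]
  simp

def cc (w : Fin n × Fin k → ℂ) : XYVars n k → ℂ := Sum.elim w (fun p => (starRingEnd ℂ) (w p))

theorem FF_integrable (z : Fin n × Fin k → ℂ) (P : MvPolynomial (XYVars n k) ℂ) :
    Integrable (fun w => KK z w * MvPolynomial.eval (cc w) P) := by
  induction P using MvPolynomial.induction_on' with
  | monomial s a =>
    have : (fun w => KK z w * MvPolynomial.eval (cc w) (MvPolynomial.monomial s a)) =
        fun w => a * ∏ p, (k1 (z p) (w p) *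
          ((w p) ^ (s (Sum.inl p)) * (starRingEnd ℂ) (w p) ^ (s (Sum.inr p)))) := by
      ext w
      rw [KK_prod, MvPolynomial.eval_monomial, Finsupp.prod_fintype _ _ (by simp),
        Fintype.prod_sum_type, Finset.prod_mul_distrib, Finset.prod_mul_distrib]
      simp only [cc, Sum.elim_inl, Sum.elim_inr]
      ring
    rw [this]
    apply Integrable.const_mul
    exact Integrable.fintype_prod (f := fun p (w : ℂ) => k1 (z p) w *
          (w ^ (s (Sum.inl p)) * (starRingEnd ℂ) w ^ (s (Sum.inr p))))
          (fun p => k1_integrable _ _ _)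
  | add p q hp hq =>
    simp only [map_add, mul_add]
    exact hp.add hq

def II (z : Fin n × Fin k → ℂ) : MvPolynomial (XYVars n k) ℂ →ₗ[ℂ] ℂ where
  toFun P := ∫ w, KK z w * MvPolynomial.eval (cc w) P
  map_add' P Q := by
    simp only [map_add, mul_add]
    exact integral_add (FF_integrable z P) (FF_integrable z Q)
  map_smul' a P := by
    simp only [MvPolynomial.smul_eval, RingHom.id_apply, smul_eq_mul]
    rw [← integral_const_mul]
    congr 1
    ext w
    ring

theorem II_one (z : Fin n × Fin k → ℂ) : II z 1 =
    (Real.pi : ℂ) ^ (n * k) * Complex.exp (-herm z z) := by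
  rw [← KK_int]
  simp [II]

theorem eval_deriv {σ : Type*} [Fintype σ] (f : ℝ → σ → ℂ) (f' : σ → ℂ) (t : ℝ)
    (h : ∀ i, HasDerivAt (fun t => f t i) (f' i) t) (P : MvPolynomial σ ℂ) :
    HasDerivAt (fun t => MvPolynomial.eval (f t) P)
      (∑ i, f' i * MvPolynomial.eval (f t) (MvPolynomial.pderiv i P)) t := by
  classical
  induction P using MvPolynomial.induction_on with
  | C a => simpa using hasDerivAt_const t a
  | add p q hp hq =>
    simp only [map_add, mul_add, Finset.sum_add_distrib]
    exact hp.add hq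
  | mul_X p i hp =>
    simp only [map_mul, MvPolynomial.eval_X]
    refine (hp.mul (h i)).congr_deriv ?_
    symm
    simp only [Derivation.leibniz, MvPolynomial.pderiv_X, smul_eq_mul, map_add, map_mul, mul_add,
      Finset.sum_add_distrib, MvPolynomial.eval_X]
    rw [add_comm, Finset.sum_mul]
    congr 1
    · exact Finset.sum_congr rfl fun j _ => by ring
    · rw [Finset.sum_eq_single i]
      · simp; ring
      · intro j _ hj; simp [Pi.single_apply, hj.symm]
      · simp

theorem herm_single_left (q : Fin n × Fin k) (c : ℂ) (w : Fin n × Fin k → ℂ) :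
    herm (Pi.single q c) w = c * (starRingEnd ℂ) (w q) := by
  classical
  rw [herm, Finset.sum_eq_single q] <;> simp +contextual [Pi.single_apply]

theorem herm_single_right (q : Fin n × Fin k) (c : ℂ) (w : Fin n × Fin k → ℂ) :
    herm w (Pi.single q c) = w q * (starRingEnd ℂ) c := by
  classical
  rw [herm, Finset.sum_eq_single q] <;> simp +contextual [Pi.single_apply]

theorem herm_deriv (a a' b b' : Fin n × Fin k → ℂ) :
    HasDerivAt (fun t : ℝ => herm (a + t • a') (b + t • b')) (herm a' b + herm a b') 0 := by
  have : ∀ t : ℝ, herm (a + t • a') (b + t • b') =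
      herm a b + t * (herm a' b + herm a b') + t ^ 2 * herm a' b' := by
    intro t
    simp only [herm, Finset.mul_sum, ← Finset.sum_add_distrib]
    refine Finset.sum_congr rfl fun p _ => ?_
    simp
    ring
  simp_rw [this]
  have hid : HasDerivAt (fun t : ℝ => (t : ℂ)) 1 0 := Complex.ofRealCLM.hasDerivAt
  refine (((hid.mul_const (herm a' b + herm a b')).const_add (herm a b)).add
    ((hid.pow 2).mul_const (herm a' b'))).congr_deriv ?_
  simp

theorem FF_deriv (z : Fin n × Fin k → ℂ) (P : MvPolynomial (XYVars n k) ℂ)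
    (q : Fin n × Fin k) (c : ℂ) (w : Fin n × Fin k → ℂ) :
    HasLineDerivAt ℝ (fun w => KK z w * MvPolynomial.eval (cc w) P)
      (c * (KK z w * MvPolynomial.eval (cc w)
        (MvPolynomial.pderiv (Sum.inl q) P - MvPolynomial.X (Sum.inr q) * P
          - MvPolynomial.C (Complex.I * (starRingEnd ℂ) (z q)) * P)) +
       (starRingEnd ℂ) c * (KK z w * MvPolynomial.eval (cc w)
        (MvPolynomial.pderiv (Sum.inr q) P - MvPolynomial.X (Sum.inl q) * P
          - MvPolynomial.C (Complex.I * z q) * P))) w (Pi.single q c) := by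
  classical
  unfold HasLineDerivAt
  have h1 : HasDerivAt (fun t : ℝ => herm (w + t • (Pi.single q c : Fin n × Fin k → ℂ)) z)
      (c * (starRingEnd ℂ) (z q)) 0 := by
    have := herm_deriv w (Pi.single q c) z 0
    rw [herm_single_left] at this
    simpa [herm] using this
  have h2 : HasDerivAt (fun t : ℝ => herm z (w + t • (Pi.single q c : Fin n × Fin k → ℂ)))
      (z q * (starRingEnd ℂ) c) 0 := by
    have := herm_deriv z 0 w (Pi.single q c)
    rw [herm_single_right] at this
    simpa [herm] using this
  have h3 := herm_deriv w (Pi.single q c) w (Pi.single q c)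
  rw [herm_single_left, herm_single_right] at h3
  have h4 := eval_deriv (fun t : ℝ => cc (w + t • (Pi.single q c : Fin n × Fin k → ℂ))) (cc (Pi.single q c)) 0 (by
    have hid : HasDerivAt (fun t : ℝ => (t : ℂ)) 1 0 := Complex.ofRealCLM.hasDerivAt
    rintro (p | p)
    · simpa [cc] using (hid.mul_const ((Pi.single q c : Fin n × Fin k → ℂ) p)).const_add (w p)
    · simpa [cc] using (hid.mul_const ((starRingEnd ℂ) ((Pi.single q c : Fin n × Fin k → ℂ) p))).const_add
        ((starRingEnd ℂ) (w p))) P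
  have h5 : (∑ i, cc (Pi.single q c) i * MvPolynomial.eval (cc (w + (0 : ℝ) • (Pi.single q c : Fin n × Fin k → ℂ)))
      (MvPolynomial.pderiv i P)) =
      c * MvPolynomial.eval (cc w) (MvPolynomial.pderiv (Sum.inl q) P) +
      (starRingEnd ℂ) c * MvPolynomial.eval (cc w) (MvPolynomial.pderiv (Sum.inr q) P) := by
    rw [Fintype.sum_sum_type, zero_smul, add_zero, Finset.sum_eq_single q, Finset.sum_eq_single q]
    all_goals simp +contextual [cc, Pi.single_apply]
  rw [h5] at h4
  have h6 := ((((h1.const_mul (-Complex.I)).cexp).mul ((h2.const_mul (-Complex.I)).cexp)).mul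
    (h3.neg.cexp)).mul h4
  refine h6.congr_deriv ?_
  symm
  simp only [Pi.mul_apply, zero_smul, add_zero, KK, map_sub, map_mul, MvPolynomial.eval_C,
    MvPolynomial.eval_X]
  simp only [cc, Sum.elim_inl, Sum.elim_inr, Pi.neg_apply, Pi.smul_apply]
  simp
  ring

theorem II_parts (z : Fin n × Fin k → ℂ) (P : MvPolynomial (XYVars n k) ℂ)
    (q : Fin n × Fin k) (c : ℂ) :
    c * II z (MvPolynomial.pderiv (Sum.inl q) P - MvPolynomial.X (Sum.inr q) * P
          - MvPolynomial.C (Complex.I * (starRingEnd ℂ) (z q)) * P) +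
    (starRingEnd ℂ) c * II z (MvPolynomial.pderiv (Sum.inr q) P - MvPolynomial.X (Sum.inl q) * P
          - MvPolynomial.C (Complex.I * z q) * P) = 0 := by
  have hA := (FF_integrable z (MvPolynomial.pderiv (Sum.inl q) P - MvPolynomial.X (Sum.inr q) * P
          - MvPolynomial.C (Complex.I * (starRingEnd ℂ) (z q)) * P)).const_mul c
  have hB := (FF_integrable z (MvPolynomial.pderiv (Sum.inr q) P - MvPolynomial.X (Sum.inl q) * P
          - MvPolynomial.C (Complex.I * z q) * P)).const_mul ((starRingEnd ℂ) c)
  have hF := FF_integrable z P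
  have := integral_bilinear_hasLineDerivAt_right_eq_neg_left_of_integrable
    (μ := (volume : Measure (Fin n × Fin k → ℂ)))
    (f := fun _ => (1 : ℂ)) (f' := fun _ => 0) (v := Pi.single q c)
    (g := fun w => KK z w * MvPolynomial.eval (cc w) P) (B := ContinuousLinearMap.mul ℝ ℂ)
    (by simp) (by simp only [ContinuousLinearMap.mul_apply', one_mul]; exact hA.add hB) (by simpa using hF)
    (fun x _ => by simpa [HasLineDerivAt] using hasDerivAt_const (0 : ℝ) (1 : ℂ))
    (fun w _ => FF_deriv z P q c w)
  simp only [ContinuousLinearMap.mul_apply', one_mul, zero_mul, integral_zero, neg_zero] at this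
  rw [integral_add hA hB, integral_const_mul, integral_const_mul] at this
  exact this

theorem aux_AB {A B : ℂ} (h1 : A + B = 0) (h2 : Complex.I * A + -Complex.I * B = 0) :
    A = 0 ∧ B = 0 := by
  have h3 : A - B = 0 := by
    have : Complex.I * (A - B) = 0 := by rw [← h2]; ring
    exact (mul_eq_zero.mp this).resolve_left Complex.I_ne_zero
  constructor
  · linear_combination (1/2) * h1 + (1/2) * h3
  · linear_combination (1/2) * h1 - (1/2) * h3

theorem II_X (z : Fin n × Fin k → ℂ) (i : XYVars n k) (P : MvPolynomial (XYVars n k) ℂ) :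
    II z (MvPolynomial.X i * P) = (Sum.elim (fun p => -Complex.I * z p)
      (fun p => -Complex.I * (starRingEnd ℂ) (z p)) : XYVars n k → ℂ) i * II z P +
      II z (MvPolynomial.pderiv i.swap P) := by
  have key : ∀ q, _ := fun q => II_parts z P q 1
  have key2 : ∀ q, _ := fun q => II_parts z P q Complex.I
  simp only [map_sub, ← MvPolynomial.smul_eq_C_mul, map_smul, smul_eq_mul, map_one, one_mul,
    Complex.conj_I] at key key2
  rcases i with q | q
  · have a := (aux_AB (key q) (key2 q)).2
    simp only [Sum.elim_inl, Sum.swap_inl]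
    linear_combination -a
  · have a := (aux_AB (key q) (key2 q)).1
    simp only [Sum.elim_inr, Sum.swap_inr]
    linear_combination -a

end

/-- Lemma `intlemma`: let `P(X,Y)` be a homogeneous polynomial in the entries of
`X, Y ∈ M_{n,k}(ℂ) ≅ ℂ^N` (`N = nk`).  If for every `z ∈ ℂ^N`
`∫_{ℂ^N} e^{−i⟨w,z⟩} e^{−i⟨z,w⟩} e^{−⟨w,w⟩} P(w, w̄) |dw|² = (2π)^N e^{−⟨z,z⟩} P(−iz, −iz̄)`,
where `|dw|² = 2^N ×` Lebesgue measure, then `P` is harmonic. -/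
theorem stmt10 (n k v : ℕ) (P : MvPolynomial (XYVars n k) ℂ)
    (hhom : ∀ A B : Matrix (Fin n) (Fin n) ℂ, IsUnit A.det → IsUnit B.det →
      substAB A B P = MvPolynomial.C (A.det ^ v * B.det ^ v) * P)
    (hint : ∀ z : Fin n × Fin k → ℂ,
      (2 : ℂ) ^ (n * k) *
          ∫ w : Fin n × Fin k → ℂ,
            Complex.exp (-Complex.I * herm w z) * Complex.exp (-Complex.I * herm z w) *
              Complex.exp (-herm w w) * evalP P w (fun p => (starRingEnd ℂ) (w p)) =
        (2 * Real.pi) ^ (n * k) * Complex.exp (-herm z z) *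
          evalP P (fun p => -Complex.I * z p)
            (fun p => -Complex.I * (starRingEnd ℂ) (z p))) :
    Harmonic P := by
  have hI : ∀ z, II z P = II z 1 * MvPolynomial.eval (Sum.elim (fun p => -Complex.I * z p)
      (fun p => -Complex.I * (starRingEnd ℂ) (z p))) P := by
    intro z
    have h := hint z
    have h2 : (2 : ℂ) ^ (n * k) ≠ 0 := pow_ne_zero _ two_ne_zero
    apply mul_left_cancel₀ h2
    refine Eq.trans h ?_
    rw [II_one, mul_pow, evalP]
    ring
  obtain ⟨m, hm⟩ := LL_nil P
  rw [LL_harm]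
  apply harm_of_EE P m hm
  rw [← sub_eq_zero]
  have hz : ∀ z, II z (EE n k m P - P) = 0 := by
    intro z
    rw [map_sub, II_EE' (II z) _ (II_X z) P m hm, hI, sub_self]
  obtain ⟨r, hr⟩ := LL_nil (EE n k m P - P)
  obtain ⟨Q, hQ, hE⟩ := EE_surj r _ hr
  have hQ0 : Q = 0 := by
    apply dense_zero
    intro z
    have h := II_EE' (II z) _ (II_X z) Q r hQ
    rw [hE, hz, II_one] at h
    have hne : (Real.pi : ℂ) ^ (n * k) * Complex.exp (-herm z z) ≠ 0 :=
      mul_ne_zero (pow_ne_zero _ (by exact_mod_cast Real.pi_ne_zero)) (Complex.exp_ne_zero _)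
    exact (mul_eq_zero.mp h.symm).resolve_left hne
  rw [← hE, hQ0, map_zero]
end
end
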